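/- For any boundary data, there is at most one stable positive solution: if u and v are positive C² solutions of Δw = 1/w on a bounded domain Ω with u = v on ∂Ω and u ≠ v, and u ≥ v on Ω, then v is not stable; i.e., there exists a test function ζ (namely ζ = u - v) with ∫_Ω ζ²/v² > ∫_Ω |Dζ|². -/

import Mathlib

open MeasureTheory Real

noncomputable def laplacian {n : ℕ} (u : EuclideanSpace ℝ (Fin n) → ℝ)
    (x : EuclideanSpace ℝ (Fin n)) : ℝ :=
  ∑ i, fderiv ℝ (fun y => fderiv ℝ u y (EuclideanSpace.single i 1)) x
    (EuclideanSpace.single i 1)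

open scoped Topology
open Set Filter

lemma ContDiffOn.exists_norm_iteratedFDeriv_le_of_isCompact_closure
    {E F : Type*} [NormedAddCommGroup E] [NormedSpace ℝ E]
    [NormedAddCommGroup F] [NormedSpace ℝ F] {s : Set E} {f : E → F} {m : ℕ}
    (hs : IsOpen s) (hc : IsCompact (closure s)) (hf : ContDiffOn ℝ m f (closure s)) :
    ∃ C, ∀ x ∈ s, ‖iteratedFDeriv ℝ m f x‖ ≤ C := by
  suffices h : ∃ C, ∀ x ∈ closure s ∩ s, ‖iteratedFDeriv ℝ m f x‖ ≤ C by
    obtain ⟨C, hC⟩ := h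
    exact ⟨C, fun x hx => hC x ⟨subset_closure hx, hx⟩⟩
  refine hc.induction_on (p := fun t => ∃ C, ∀ x ∈ t ∩ s, ‖iteratedFDeriv ℝ m f x‖ ≤ C)
    ⟨0, by simp⟩ ?_ ?_ ?_
  · rintro t t' htt ⟨C, hC⟩
    exact ⟨C, fun x hx => hC x ⟨htt hx.1, hx.2⟩⟩
  · rintro t t' ⟨C, hC⟩ ⟨C', hC'⟩
    refine ⟨max C C', ?_⟩
    rintro x ⟨hx | hx, hxs⟩
    · exact (hC x ⟨hx, hxs⟩).trans (le_max_left _ _)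
    · exact (hC' x ⟨hx, hxs⟩).trans (le_max_right _ _)
  · intro x hx
    obtain ⟨t, ht, p, hp⟩ := contDiffWithinAt_nat.1 (hf x hx)
    rw [insert_eq_of_mem hx] at ht
    have hxt : x ∈ t := mem_of_mem_nhdsWithin hx ht
    have hcont : ContinuousWithinAt (fun y => ‖p y m‖) (closure s) x :=
      (((hp.cont m le_rfl) x hxt).mono_of_mem_nhdsWithin ht).norm
    have hlt : ∀ᶠ y in 𝓝[closure s] x, ‖p y m‖ < ‖p x m‖ + 1 :=
      hcont.eventually_lt_const (lt_add_one _)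
    obtain ⟨o, ho, hxo, hot⟩ := mem_nhdsWithin.1 (inter_mem ht hlt)
    refine ⟨o, mem_nhdsWithin_of_mem_nhds (ho.mem_nhds hxo), ‖p x m‖ + 1, fun y hy => ?_⟩
    have hsub : o ∩ s ⊆ t := fun z hz => (hot ⟨hz.1, subset_closure hz.2⟩).1
    rw [← iteratedFDerivWithin_of_isOpen m (ho.inter hs) hy,
      ← (hp.mono hsub).eq_iteratedFDerivWithin_of_uniqueDiffOn le_rfl
        (ho.inter hs).uniqueDiffOn hy]
    exact (hot ⟨hy.1, subset_closure hy.2⟩).2.le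

section CompactSupport

variable {E : Type*} [NormedAddCommGroup E]

lemma hasCompactSupport_indicator_of_eqOn_diff {s K : Set E} {g : E → ℝ} (hK : IsCompact K)
    (h0 : ∀ x ∈ s \ K, g x = 0) : HasCompactSupport (s.indicator g) := by
  refine HasCompactSupport.intro hK fun x hx => ?_
  by_cases hxs : x ∈ s
  · rw [indicator_of_mem hxs, h0 x ⟨hxs, hx⟩]
  · exact indicator_of_notMem hxs g

variable [NormedSpace ℝ E]

lemma contDiff_indicator_of_eqOn_diff {s K : Set E} {g : E → ℝ} (hs : IsOpen s)
    (hK : IsCompact K) (hKs : K ⊆ s) (hg : ContDiffOn ℝ 1 g s) (h0 : ∀ x ∈ s \ K, g x = 0) :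
    ContDiff ℝ 1 (s.indicator g) := by
  refine contDiff_iff_contDiffAt.2 fun x => ?_
  by_cases hx : x ∈ s
  · refine (hg.contDiffAt (hs.mem_nhds hx)).congr_of_eventuallyEq ?_
    filter_upwards [hs.mem_nhds hx] with y hy using indicator_of_mem hy g
  · have hxK : x ∈ Kᶜ := fun h => hx (hKs h)
    refine (contDiffAt_const (c := (0 : ℝ))).congr_of_eventuallyEq ?_
    filter_upwards [hK.isClosed.isOpen_compl.mem_nhds hxK] with y hy
    by_cases hys : y ∈ s
    · rw [indicator_of_mem hys, h0 y ⟨hys, hy⟩]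
    · exact indicator_of_notMem hys g

variable [MeasurableSpace E] [BorelSpace E]

lemma ContDiff.integrable_fderiv_apply {μ : Measure E} [IsFiniteMeasureOnCompacts μ] {g : E → ℝ}
    (hg : ContDiff ℝ 1 g) (hc : HasCompactSupport g) (e : E) :
    Integrable (fun x => fderiv ℝ g x e) μ :=
  ((hg.continuous_fderiv one_ne_zero).clm_apply continuous_const).integrable_of_hasCompactSupport
    (hc.fderiv_apply ℝ e)

lemma ContDiff.integral_fderiv_apply_eq_zero [FiniteDimensional ℝ E]
    {μ : Measure E} [μ.IsAddHaarMeasure] {g : E → ℝ} (hg : ContDiff ℝ 1 g)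
    (hc : HasCompactSupport g) (e : E) :
    ∫ x, fderiv ℝ g x e ∂μ = 0 := by
  have h := integral_mul_fderiv_eq_neg_fderiv_mul_of_integrable (μ := μ) (f := fun _ => (1 : ℝ))
    (g := g) (v := e) (by simp) (by simpa using hg.integrable_fderiv_apply hc e)
    (by simpa using hg.continuous.integrable_of_hasCompactSupport hc)
    (fun x _ => differentiableAt_const _) (fun x _ => hg.differentiable one_ne_zero x)
  simpa using h

end CompactSupport

section Laplacian

variable {n : ℕ}

lemma norm_gradient_sq (f : EuclideanSpace ℝ (Fin n) → ℝ) (x : EuclideanSpace ℝ (Fin n)) :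
    ‖gradient f x‖ ^ 2 = ∑ i, fderiv ℝ f x (EuclideanSpace.single i 1) ^ 2 := by
  rw [EuclideanSpace.real_norm_sq_eq]
  refine Finset.sum_congr rfl fun i _ => ?_
  have h : inner ℝ (gradient f x) (EuclideanSpace.single i 1) =
      fderiv ℝ f x (EuclideanSpace.single i 1) := by
    simp [gradient]
  rw [← h]
  simp only [EuclideanSpace.inner_single_right, one_mul, conj_trivial]

lemma norm_gradient (f : EuclideanSpace ℝ (Fin n) → ℝ) (x : EuclideanSpace ℝ (Fin n)) :
    ‖gradient f x‖ = ‖fderiv ℝ f x‖ := by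
  simp [gradient]

variable {Ω : Set (EuclideanSpace ℝ (Fin n))} {u v : EuclideanSpace ℝ (Fin n) → ℝ}

lemma ContDiffOn.fderiv_apply_of_isOpen (hΩ : IsOpen Ω) (hu : ContDiffOn ℝ 2 u Ω)
    (e : EuclideanSpace ℝ (Fin n)) : ContDiffOn ℝ 1 (fun y => fderiv ℝ u y e) Ω :=
  (hu.fderiv_of_isOpen hΩ (by norm_num)).clm_apply contDiffOn_const

lemma laplacian_sub (hΩ : IsOpen Ω) (hu : ContDiffOn ℝ 2 u Ω) (hv : ContDiffOn ℝ 2 v Ω)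
    {x : EuclideanSpace ℝ (Fin n)} (hx : x ∈ Ω) :
    laplacian (fun y => u y - v y) x = laplacian u x - laplacian v x := by
  simp only [laplacian, ← Finset.sum_sub_distrib]
  refine Finset.sum_congr rfl fun i _ => ?_
  set e : EuclideanSpace ℝ (Fin n) := EuclideanSpace.single i 1
  have hdiff : ∀ {f : EuclideanSpace ℝ (Fin n) → ℝ}, ContDiffOn ℝ 2 f Ω →
      DifferentiableAt ℝ (fun y => fderiv ℝ f y e) x := fun hf =>
    ((hf.fderiv_apply_of_isOpen hΩ e).contDiffAt (hΩ.mem_nhds hx)).differentiableAt one_ne_zero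
  have heq : (fun y => fderiv ℝ (fun z => u z - v z) y e) =ᶠ[𝓝 x]
      fun y => fderiv ℝ u y e - fderiv ℝ v y e := by
    filter_upwards [hΩ.mem_nhds hx] with y hy
    have hu' := (hu.contDiffAt (hΩ.mem_nhds hy)).differentiableAt two_ne_zero
    have hv' := (hv.contDiffAt (hΩ.mem_nhds hy)).differentiableAt two_ne_zero
    rw [fderiv_fun_sub hu' hv']
    rfl
  rw [heq.fderiv_eq, fderiv_fun_sub (hdiff hu) (hdiff hv)]
  rfl

lemma exists_laplacian_le (hΩ : IsOpen Ω) (hbd : Bornology.IsBounded Ω)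
    (hu : ContDiffOn ℝ 2 u (closure Ω)) : ∃ C, ∀ x ∈ Ω, laplacian u x ≤ C := by
  obtain ⟨C, hC⟩ := hu.exists_norm_iteratedFDeriv_le_of_isCompact_closure (m := 2) hΩ
    hbd.isCompact_closure
  refine ⟨∑ _i : Fin n, C, fun x hx => Finset.sum_le_sum fun i _ => ?_⟩
  set e : EuclideanSpace ℝ (Fin n) := EuclideanSpace.single i 1 with he
  have hd : DifferentiableAt ℝ (fderiv ℝ u) x :=
    (((hu.mono subset_closure).fderiv_of_isOpen (m := 1) hΩ (by norm_num)).contDiffAt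
      (hΩ.mem_nhds hx)).differentiableAt one_ne_zero
  have h1 : fderiv ℝ (fun y => fderiv ℝ u y e) x e = iteratedFDeriv ℝ 2 u x ![e, e] := by
    rw [iteratedFDeriv_two_apply, fderiv_clm_apply hd (differentiableAt_const _)]
    simp
  rw [h1]
  refine (le_abs_self _).trans (((iteratedFDeriv ℝ 2 u x).le_opNorm ![e, e]).trans ?_)
  simpa [Fin.prod_univ_two, he] using hC x hx

lemma setIntegral_deriv_mul_norm_gradient_sq_add_mul_laplacian_eq_zero
    (hΩ : IsOpen Ω) (hbd : Bornology.IsBounded Ω) (hu : ContDiffOn ℝ 2 u Ω)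
    (huc : ContinuousOn u (closure Ω)) (h0 : ∀ x ∈ frontier Ω, u x = 0)
    {F F' : ℝ → ℝ} (hF : ∀ t, HasDerivAt F (F' t) t) (hF' : Continuous F')
    {ε : ℝ} (hε : 0 < ε) (hF0 : ∀ t ≤ ε, F t = 0) :
    IntegrableOn (fun x => F' (u x) * ‖gradient u x‖ ^ 2 + F (u x) * laplacian u x) Ω ∧
    ∫ x in Ω, (F' (u x) * ‖gradient u x‖ ^ 2 + F (u x) * laplacian u x) = 0 := by
  set K : Set (EuclideanSpace ℝ (Fin n)) := closure Ω ∩ u ⁻¹' Ici ε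
  have hK : IsCompact K := hbd.isCompact_closure.of_isClosed_subset
    (huc.preimage_isClosed_of_isClosed isClosed_closure isClosed_Ici) inter_subset_left
  have hKΩ : K ⊆ Ω := by
    rintro x ⟨hx, hux⟩
    by_contra hxΩ
    have h := h0 x ⟨hx, fun h => hxΩ (interior_subset h)⟩
    have : ε ≤ u x := hux
    linarith
  have hFC : ContDiff ℝ 1 F := by
    refine contDiff_one_iff_deriv.2 ⟨fun t => (hF t).differentiableAt, ?_⟩
    rwa [funext fun t => (hF t).deriv]
  let g : Fin n → EuclideanSpace ℝ (Fin n) → ℝ := fun i x =>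
    F (u x) * fderiv ℝ u x (EuclideanSpace.single i 1)
  have hg : ∀ i, ContDiffOn ℝ 1 (g i) Ω := fun i =>
    (hFC.comp_contDiffOn (hu.of_le (by norm_num))).mul (hu.fderiv_apply_of_isOpen hΩ _)
  have hg0 : ∀ i, ∀ x ∈ Ω \ K, g i x = 0 := by
    rintro i x ⟨hx, hxK⟩
    have hlt : u x ≤ ε := le_of_not_ge fun h => hxK ⟨subset_closure hx, h⟩
    simp [g, hF0 _ hlt]
  have hGc := fun i => hasCompactSupport_indicator_of_eqOn_diff hK (hg0 i)
  have hGd := fun i => contDiff_indicator_of_eqOn_diff hΩ hK hKΩ (hg i) (hg0 i)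
  set D : EuclideanSpace ℝ (Fin n) → ℝ := fun x =>
    ∑ i, fderiv ℝ (Ω.indicator (g i)) x (EuclideanSpace.single i 1)
  have hDint : Integrable D volume :=
    integrable_finsetSum _ fun i _ => (hGd i).integrable_fderiv_apply (hGc i) _
  have hD0 : ∫ x, D x = 0 := by
    rw [integral_finsetSum _ fun i _ => (hGd i).integrable_fderiv_apply (hGc i) _]
    exact Finset.sum_eq_zero fun i _ => (hGd i).integral_fderiv_apply_eq_zero (hGc i) _
  have hDout : ∀ x, x ∉ Ω → D x = 0 := by
    intro x hx
    refine Finset.sum_eq_zero fun i _ => ?_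
    have : Ω.indicator (g i) =ᶠ[𝓝 x] fun _ => (0 : ℝ) := by
      filter_upwards [hK.isClosed.isOpen_compl.mem_nhds fun h => hx (hKΩ h)] with y hy
      by_cases hyΩ : y ∈ Ω
      · rw [indicator_of_mem hyΩ, hg0 i y ⟨hyΩ, hy⟩]
      · exact indicator_of_notMem hyΩ _
    rw [this.fderiv_eq]
    simp
  have hDin : EqOn D (fun x => F' (u x) * ‖gradient u x‖ ^ 2 + F (u x) * laplacian u x) Ω := by
    intro x hx
    have hux := (hu.contDiffAt (hΩ.mem_nhds hx)).differentiableAt two_ne_zero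
    simp only [D, norm_gradient_sq, laplacian, Finset.mul_sum, ← Finset.sum_add_distrib]
    refine Finset.sum_congr rfl fun i _ => ?_
    set e : EuclideanSpace ℝ (Fin n) := EuclideanSpace.single i 1
    have hue := ((hu.fderiv_apply_of_isOpen hΩ e).contDiffAt
      (hΩ.mem_nhds hx)).differentiableAt one_ne_zero
    have heq : Ω.indicator (g i) =ᶠ[𝓝 x] g i := by
      filter_upwards [hΩ.mem_nhds hx] with y hy using indicator_of_mem hy _
    have hder := ((hF (u x)).comp_hasFDerivAt x hux.hasFDerivAt).mul hue.hasFDerivAt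
    have hgder : fderiv ℝ (g i) x = _ := hder.fderiv
    rw [heq.fderiv_eq, hgder]
    simp only [add_apply, smul_apply, smul_eq_mul,
      Function.comp_apply]
    ring
  refine ⟨hDint.integrableOn.congr_fun hDin hΩ.measurableSet, ?_⟩
  rw [← setIntegral_congr_fun hΩ.measurableSet hDin,
    setIntegral_eq_integral_of_forall_compl_eq_zero hDout, hD0]

lemma setIntegral_norm_gradient_sq_le_of_laplacian_nonpos
    (hΩ : IsOpen Ω) (hbd : Bornology.IsBounded Ω) (hu : ContDiffOn ℝ 2 u (closure Ω))
    (h0 : ∀ x ∈ frontier Ω, u x = 0) (hnonneg : ∀ x ∈ Ω, 0 ≤ u x)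
    (hlap : ∀ x ∈ Ω, laplacian u x ≤ 0)
    (hui : IntegrableOn (fun x => u x * -laplacian u x) Ω) :
    ∫ x in Ω, ‖gradient u x‖ ^ 2 ≤ ∫ x in Ω, u x * -laplacian u x := by
  have huΩ : ContDiffOn ℝ 2 u Ω := hu.mono subset_closure
  obtain ⟨C, hC⟩ := (hu.of_le (m := 1) (by norm_num)
    ).exists_norm_iteratedFDeriv_le_of_isCompact_closure (m := 1) hΩ hbd.isCompact_closure
  have hgC : ∀ x ∈ Ω, ‖gradient u x‖ ≤ C := fun x hx => by
    rw [norm_gradient, ← norm_iteratedFDeriv_one]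
    exact hC x hx
  have hgcont : ContinuousOn (fun x => ‖gradient u x‖ ^ 2) Ω := by
    simp only [norm_gradient]
    exact ((huΩ.fderiv_of_isOpen (m := 1) hΩ (by norm_num)).continuousOn.norm).pow 2
  have hfin : volume Ω < ⊤ := hbd.measure_lt_top
  let φ : ℕ → ℝ → ℝ := fun k s => max 0 (min 1 (k * s - 1))
  have hφc : ∀ k, Continuous (φ k) := fun k => by fun_prop
  have hφ0 : ∀ k s, 0 ≤ φ k s := fun k s => le_max_left _ _
  have hφ1 : ∀ k s, φ k s ≤ 1 := fun k s => max_le zero_le_one (min_le_left _ _)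
  let F : ℕ → ℝ → ℝ := fun k t => ∫ s in (0 : ℝ)..t, φ k s
  have hF : ∀ k t, HasDerivAt (F k) (φ k t) t := fun k t =>
    intervalIntegral.integral_hasDerivAt_right ((hφc k).intervalIntegrable _ _)
      ((hφc k).stronglyMeasurableAtFilter _ _) (hφc k).continuousAt
  have hF0 : ∀ k : ℕ, ∀ t ≤ (1 / (k + 1) : ℝ), F k t = 0 := by
    intro k t ht
    have hz : EqOn (φ k) (fun _ => 0) (uIcc 0 t) := by
      intro s hs
      have hk : (0 : ℝ) < k + 1 := by positivity
      have hs1 : s ≤ 1 / (k + 1) := hs.2.trans (max_le (by positivity) ht)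
      rw [le_div_iff₀ hk] at hs1
      refine max_eq_left ((min_le_right _ _).trans ?_)
      rcases le_or_gt 0 s with h | h
      · nlinarith
      · have : (k : ℝ) * s ≤ 0 := mul_nonpos_of_nonneg_of_nonpos (by positivity) h.le
        linarith
    simp only [F]
    rw [intervalIntegral.integral_congr hz]
    simp
  have hFle : ∀ k t, 0 ≤ t → F k t ≤ t := by
    intro k t ht
    have := intervalIntegral.integral_mono_on ht ((hφc k).intervalIntegrable (μ := volume) 0 t)
      (continuous_const.intervalIntegrable 0 t) fun s _ => hφ1 k s
    simpa using this
  have hle : ∀ k, ∫ x in Ω, φ k (u x) * ‖gradient u x‖ ^ 2 ≤ ∫ x in Ω, u x * -laplacian u x := by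
    intro k
    obtain ⟨hi, hI⟩ := setIntegral_deriv_mul_norm_gradient_sq_add_mul_laplacian_eq_zero hΩ hbd huΩ
      hu.continuousOn h0 (hF k) (hφc k) (by positivity) (hF0 k)
    calc ∫ x in Ω, φ k (u x) * ‖gradient u x‖ ^ 2
        ≤ ∫ x in Ω, ((φ k (u x) * ‖gradient u x‖ ^ 2 + F k (u x) * laplacian u x)
            + u x * -laplacian u x) := by
          refine integral_mono_of_nonneg
            (Eventually.of_forall fun x => mul_nonneg (hφ0 _ _) (sq_nonneg _)) (hi.add hui) ?_
          filter_upwards [ae_restrict_mem hΩ.measurableSet] with x hx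
          have := mul_nonneg (sub_nonneg.2 (hFle k (u x) (hnonneg x hx)))
            (neg_nonneg.2 (hlap x hx))
          nlinarith
      _ = ∫ x in Ω, u x * -laplacian u x := by
          rw [integral_add hi hui, hI, zero_add]
  refine le_of_tendsto (tendsto_integral_of_dominated_convergence (fun _ => C ^ 2) ?_ ?_ ?_ ?_)
    (Eventually.of_forall hle)
  · exact fun k => (((hφc k).comp_continuousOn huΩ.continuousOn).mul hgcont).aestronglyMeasurable
      hΩ.measurableSet
  · exact integrableOn_const hfin.ne
  · intro k
    filter_upwards [ae_restrict_mem hΩ.measurableSet] with x hx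
    rw [Real.norm_of_nonneg (mul_nonneg (hφ0 _ _) (sq_nonneg _))]
    calc φ k (u x) * ‖gradient u x‖ ^ 2 ≤ 1 * ‖gradient u x‖ ^ 2 := by
          gcongr
          exact hφ1 _ _
      _ ≤ C ^ 2 := by
          rw [one_mul]
          gcongr
          exact hgC x hx
  · filter_upwards [ae_restrict_mem hΩ.measurableSet] with x hx
    rcases (hnonneg x hx).eq_or_lt with h | h
    · have hmin : IsLocalMin u x := by
        filter_upwards [hΩ.mem_nhds hx] with y hy
        rw [← h]
        exact hnonneg y hy
      have : ‖gradient u x‖ = 0 := by rw [norm_gradient, hmin.fderiv_eq_zero, norm_zero]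
      simp [this]
    · refine tendsto_const_nhds.congr' ?_
      filter_upwards [(tendsto_natCast_atTop_atTop (R := ℝ)).eventually_ge_atTop (2 / u x)]
        with k hk
      rw [div_le_iff₀ h] at hk
      have : φ k (u x) = 1 := by
        simp only [φ]
        rw [min_eq_left (by linarith), max_eq_right zero_le_one]
      rw [this, one_mul]

end Laplacian

/-- A non-maximal positive solution is not stable: if `u ≥ v` are distinct positive
solutions with the same boundary data, then `ζ = u - v` violates the stability
inequality for `v`. -/
theorem stmt8 (n : ℕ) (Ω : Set (EuclideanSpace ℝ (Fin n))) (hΩ : IsOpen Ω)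
    (hbd : Bornology.IsBounded Ω)
    (u v : EuclideanSpace ℝ (Fin n) → ℝ)
    (hu : ContDiffOn ℝ 2 u (closure Ω)) (hv : ContDiffOn ℝ 2 v (closure Ω))
    (hupos : ∀ x ∈ Ω, 0 < u x) (hvpos : ∀ x ∈ Ω, 0 < v x)
    (hueq : ∀ x ∈ Ω, laplacian u x = 1 / u x)
    (hveq : ∀ x ∈ Ω, laplacian v x = 1 / v x)
    (hbdry : ∀ x ∈ frontier Ω, u x = v x)
    (hge : ∀ x ∈ Ω, v x ≤ u x)
    (hne : ∃ x ∈ Ω, u x ≠ v x) :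
    ∫ x in Ω, (u x - v x) ^ 2 / (v x) ^ 2 >
      ∫ x in Ω, ‖gradient (fun y => u y - v y) x‖ ^ 2 := by
  have huΩ := hu.mono (subset_closure (s := Ω))
  have hvΩ := hv.mono (subset_closure (s := Ω))
  have hfin : volume Ω < ⊤ := hbd.measure_lt_top
  obtain ⟨C, hC⟩ := exists_laplacian_le hΩ hbd hv
  have hvC : ∀ x ∈ Ω, 1 / v x ≤ C := fun x hx => hveq x hx ▸ hC x hx
  obtain ⟨M, hM⟩ := hbd.isCompact_closure.exists_bound_of_continuousOn
    (hu.continuousOn.sub hv.continuousOn)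
  have hwM : ∀ x ∈ Ω, u x - v x ≤ M := fun x hx =>
    (le_abs_self _).trans (hM x (subset_closure hx))
  have hlap : ∀ x ∈ Ω, (u x - v x) * -laplacian (fun y => u y - v y) x =
      (u x - v x) ^ 2 / (u x * v x) := by
    intro x hx
    have h1 := (hupos x hx).ne'
    have h2 := (hvpos x hx).ne'
    rw [laplacian_sub hΩ huΩ hvΩ hx, hueq x hx, hveq x hx]
    field_simp
    ring
  have hint2 : IntegrableOn (fun x => (u x - v x) ^ 2 / (v x) ^ 2) Ω := by
    refine IntegrableOn.of_bound hfin (ContinuousOn.aestronglyMeasurable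
      (((huΩ.continuousOn.sub hvΩ.continuousOn).pow 2).div (hvΩ.continuousOn.pow 2)
        fun x hx => pow_ne_zero 2 (hvpos x hx).ne') hΩ.measurableSet) ((M * C) ^ 2) ?_
    filter_upwards [ae_restrict_mem hΩ.measurableSet] with x hx
    have hw := sub_nonneg.2 (hge x hx)
    have hv1 : 0 ≤ 1 / v x := (one_div_pos.2 (hvpos x hx)).le
    rw [Real.norm_of_nonneg (by positivity), ← div_pow, div_eq_mul_one_div]
    gcongr
    · exact hw.trans (hwM x hx)
    · exact hwM x hx
    · exact hvC x hx
  have hle : ∀ x ∈ Ω, (u x - v x) ^ 2 / (u x * v x) ≤ (u x - v x) ^ 2 / (v x) ^ 2 := by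
    intro x hx
    have h2 := hvpos x hx
    rw [sq (v x)]
    gcongr
    exact hge x hx
  have hint1 : IntegrableOn (fun x => (u x - v x) ^ 2 / (u x * v x)) Ω := by
    refine Integrable.mono' hint2 (ContinuousOn.aestronglyMeasurable
      (((huΩ.continuousOn.sub hvΩ.continuousOn).pow 2).div
        (huΩ.continuousOn.mul hvΩ.continuousOn)
        fun x hx => (mul_pos (hupos x hx) (hvpos x hx)).ne') hΩ.measurableSet) ?_
    filter_upwards [ae_restrict_mem hΩ.measurableSet] with x hx
    have h1 := hupos x hx
    have h2 := hvpos x hx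
    rw [Real.norm_of_nonneg (by positivity)]
    exact hle x hx
  have henergy : ∫ x in Ω, ‖gradient (fun y => u y - v y) x‖ ^ 2 ≤
      ∫ x in Ω, (u x - v x) ^ 2 / (u x * v x) := by
    rw [← setIntegral_congr_fun hΩ.measurableSet hlap]
    refine setIntegral_norm_gradient_sq_le_of_laplacian_nonpos hΩ hbd (hu.sub hv)
      (fun x hx => sub_eq_zero.2 (hbdry x hx)) (fun x hx => sub_nonneg.2 (hge x hx)) ?_
      (hint1.congr_fun (fun x hx => (hlap x hx).symm) hΩ.measurableSet)
    intro x hx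
    rw [laplacian_sub hΩ huΩ hvΩ hx, hueq x hx, hveq x hx]
    exact sub_nonpos.2 (one_div_le_one_div_of_le (hvpos x hx) (hge x hx))
  refine henergy.trans_lt (sub_pos.1 ?_)
  rw [← integral_sub hint2 hint1]
  refine (setIntegral_pos_iff_support_of_nonneg_ae ?_ (hint2.sub hint1)).2 ?_
  · filter_upwards [ae_restrict_mem hΩ.measurableSet] with x hx
    exact sub_nonneg.2 (hle x hx)
  · obtain ⟨x₀, hx₀, hne₀⟩ := hne
    have hopen : IsOpen (Ω ∩ (fun x => u x - v x) ⁻¹' {0}ᶜ) :=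
      (huΩ.continuousOn.sub hvΩ.continuousOn).isOpen_inter_preimage hΩ isOpen_compl_singleton
    refine (hopen.measure_pos volume ⟨x₀, hx₀, sub_ne_zero.2 hne₀⟩).trans_le
      (measure_mono ?_)
    rintro x ⟨hx, hxne⟩
    refine ⟨?_, hx⟩
    have h1 := hupos x hx
    have h2 := hvpos x hx
    have hw : 0 < u x - v x := lt_of_le_of_ne (sub_nonneg.2 (hge x hx)) (Ne.symm hxne)
    have hlt : (u x - v x) ^ 2 / (u x * v x) < (u x - v x) ^ 2 / (v x) ^ 2 := by
      rw [sq (v x)]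
      gcongr
      exact sub_pos.1 hw
    exact (sub_pos.2 hlt).ne'
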